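/- Let T be a Calderón–Zygmund operator with normalised standard kernel of Hölder exponent γ and s ∈ ℕ. Let J, K, L ∈ 𝒟 with ℓ(K) = ℓ(L), L = K∔m for some m ∈ ℤⁿ, and J ⊋ L, and let θ, η ∈ {0,1}ⁿ∖{0}. Set j := log₂(ℓ(J)/ℓ(K)) ≥ 1. Then, with C depending only on n, γ: |⟨h^θ_K, T_{4·2^s ℓ(J)} h^η_J⟩ · ⟨h^η_J, h⁰_L⟩| ≤ C [ |m|^{−n−γ} · 1{|m| > 2·2^{s+j}} + 2^{−sn} 2^{−j(n+1)} · 1{ | |m| − 4·2^{s+j} | < 1 + 2^j } ]. -/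

import Mathlib

open MeasureTheory

noncomputable section

open Classical in
/-- Classical indicator of a proposition. -/
def indR (P : Prop) : ℝ := if P then 1 else 0

/-- The real sign associated to a boolean. -/
def sgnB (b : Bool) : ℝ := if b then 1 else -1

/-- The `ℓ∞` norm of an integer vector, as a real number. -/
def inorm {n : ℕ} (m : Fin n → ℤ) : ℝ := ‖(fun i => (m i : ℝ) : Fin n → ℝ)‖

/-- The dyadic cube `2^{-k}([0,1)^n + m)` of generation `k` in `ℝ^n` (with the `ℓ∞` metric). -/
def dyadicCube (n : ℕ) (k : ℤ) (m : Fin n → ℤ) : Set (Fin n → ℝ) :=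
  {x | ∀ i, (2:ℝ) ^ (-k) * m i ≤ x i ∧ x i < (2:ℝ) ^ (-k) * (m i + 1)}

/-- The side length `2^{-k}` of a dyadic cube of generation `k`. -/
def sideLen (k : ℤ) : ℝ := (2:ℝ) ^ (-k)

/-- One-dimensional Haar function on the dyadic interval `2^{-k}[m, m+1)`:
the non-cancellative `h⁰` for `η = false`, the cancellative `h¹` for `η = true`. -/
def haar1D (k : ℤ) (m : ℤ) (η : Bool) (t : ℝ) : ℝ :=
  (Real.sqrt ((2:ℝ) ^ (-k)))⁻¹ *
    (if η then
        (Set.Ico ((2:ℝ) ^ (-k) * m) ((2:ℝ) ^ (-k) * (m + 1/2))).indicator 1 t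
          - (Set.Ico ((2:ℝ) ^ (-k) * (m + 1/2)) ((2:ℝ) ^ (-k) * (m + 1))).indicator 1 t
      else (Set.Ico ((2:ℝ) ^ (-k) * m) ((2:ℝ) ^ (-k) * (m + 1))).indicator 1 t)

/-- The Haar function `h^η_I` for the dyadic cube `I` indexed by `(k, m)`. -/
def haarFn (n : ℕ) (k : ℤ) (m : Fin n → ℤ) (η : Fin n → Bool) (x : Fin n → ℝ) : ℝ :=
  ∏ i, haar1D k (m i) (η i) (x i)

/-- The non-cancellative Haar function `h⁰_I = |I|^{-1/2} 1_I`. -/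
def haarZero (n : ℕ) (k : ℤ) (m : Fin n → ℤ) : (Fin n → ℝ) → ℝ :=
  haarFn n k m (fun _ => false)

/-- The pairing `⟨g, f⟩ = ∫ g f dx`. -/
def pairing {n : ℕ} (g f : (Fin n → ℝ) → ℝ) : ℝ := ∫ x, g x * f x

/-- A normalised standard kernel with Hölder exponent `γ` (with respect to the `ℓ∞` metric). -/
structure IsNormalisedKernel (n : ℕ) (γ : ℝ) (K : (Fin n → ℝ) → (Fin n → ℝ) → ℝ) : Prop where
  size : ∀ x y, x ≠ y → |K x y| ≤ dist x y ^ (-(n:ℝ))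
  smooth : ∀ x y h, 2 * ‖h‖ < dist x y →
    |K (x + h) y - K x y| + |K x (y + h) - K x y| ≤ ‖h‖ ^ γ * dist x y ^ (-(n:ℝ) - γ)

/-- The singular integral `Tf(x) = ∫ K(x,y) f(y) dy`. -/
def czIntegral {n : ℕ} (K : (Fin n → ℝ) → (Fin n → ℝ) → ℝ) (f : (Fin n → ℝ) → ℝ)
    (x : Fin n → ℝ) : ℝ := ∫ y, K x y * f y

/-- The truncated singular integral `T_ε f(x) = ∫_{|y-x|>ε} K(x,y) f(y) dy`. -/
def czTrunc {n : ℕ} (K : (Fin n → ℝ) → (Fin n → ℝ) → ℝ) (ε : ℝ) (f : (Fin n → ℝ) → ℝ)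
    (x : Fin n → ℝ) : ℝ := ∫ y in {y | ε < dist x y}, K x y * f y

/-- The dyadic conditional expectation `E_k f`. -/
def dyadicE (n : ℕ) (k : ℤ) (f : (Fin n → ℝ) → ℝ) (x : Fin n → ℝ) : ℝ :=
  (2:ℝ) ^ (k * (n:ℤ)) * ∫ y in dyadicCube n k (fun i => ⌊(2:ℝ) ^ k * x i⌋), f y

/-- The dyadic martingale difference `D_k f = E_{k+1} f - E_k f`. -/
def dyadicD (n : ℕ) (k : ℤ) (f : (Fin n → ℝ) → ℝ) (x : Fin n → ℝ) : ℝ :=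
  dyadicE n (k+1) f x - dyadicE n k f x

/-- The centre of the dyadic cube indexed by `(k, m)`. -/
def cubeCenter (n : ℕ) (k : ℤ) (m : Fin n → ℤ) : Fin n → ℝ :=
  fun i => (2:ℝ) ^ (-k) * (m i + 1/2)

/-- The concentric `c`-fold expansion of the dyadic cube indexed by `(k, m)`. -/
def expandCube (n : ℕ) (k : ℤ) (m : Fin n → ℤ) (c : ℝ) : Set (Fin n → ℝ) :=
  {x | ∀ i, |x i - cubeCenter n k m i| ≤ c * (2:ℝ) ^ (-k) / 2}

/-- The set `Σ_{f,s} = ⋃_k 9Ω_k`, where `Ω_k` is the union of the cubes `I ∈ 𝒟_k` on which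
`D_{k+s} f` is not a.e. zero. -/
def SigmaSet (n : ℕ) (f : (Fin n → ℝ) → ℝ) (s : ℕ) : Set (Fin n → ℝ) :=
  ⋃ (k : ℤ) (m : Fin n → ℤ)
    (_ : ¬ (∀ᵐ x ∂(volume.restrict (dyadicCube n k m)), dyadicD n (k + (s:ℤ)) f x = 0)),
      expandCube n k m 9

/-- The (measure-theoretic) support of a measurable function: the complement of the union of
all balls on which the function vanishes a.e. -/
def suppAE {n : ℕ} (f : (Fin n → ℝ) → ℝ) : Set (Fin n → ℝ) :=
  {x | ∀ r > 0, ¬ (∀ᵐ y ∂(volume.restrict (Metric.ball x r)), f y = 0)}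

/-- The axis-parallel closed cube with centre `c` and side length `ρ`. -/
def cube (n : ℕ) (c : Fin n → ℝ) (ρ : ℝ) : Set (Fin n → ℝ) :=
  {x | ∀ i, |x i - c i| ≤ ρ / 2}

/-- The index of the `s`-th dyadic ancestor `I^{(s)}` of the cube indexed by `(k, m)`
(the ancestor is the cube indexed by `(k - s, ancestorIdx s m)`). -/
def ancestorIdx {n : ℕ} (s : ℕ) (m : Fin n → ℤ) : Fin n → ℤ :=
  fun i => Int.fdiv (m i) (2 ^ s)

/-- The distance between two sets (in the ambient metric). -/
def setDist {α : Type*} [PseudoMetricSpace α] (A B : Set α) : ℝ :=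
  sInf (Set.image2 dist A B)

lemma haar1D_measurable (k m : ℤ) (η : Bool) : Measurable (haar1D k m η) := by
  unfold haar1D
  cases η
  · simpa using ((measurable_one.indicator measurableSet_Ico).const_mul _)
  · simpa using (((measurable_one.indicator measurableSet_Ico).sub
      (measurable_one.indicator measurableSet_Ico)).const_mul _)

lemma abs_haar1D_le (k m : ℤ) (η : Bool) (t : ℝ) :
    |haar1D k m η t| ≤ (Real.sqrt ((2:ℝ) ^ (-k)))⁻¹ := by
  unfold haar1D
  rw [abs_mul, abs_of_nonneg (by positivity : 0 ≤ (Real.sqrt ((2:ℝ) ^ (-k)))⁻¹)]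
  refine mul_le_of_le_one_right (by positivity) ?_
  cases η <;> simp only [Set.indicator, Set.mem_Ico, Pi.one_apply] <;> split_ifs <;> norm_num

lemma haar1D_eq_zero (k m : ℤ) (η : Bool) (t : ℝ)
    (ht : ¬ ((2:ℝ) ^ (-k) * m ≤ t ∧ t < (2:ℝ) ^ (-k) * (m + 1))) :
    haar1D k m η t = 0 := by
  have hℓ : (0:ℝ) < 2 ^ (-k) := by positivity
  unfold haar1D
  generalize (2:ℝ) ^ (-k) = l at *
  have h1 : ¬ (l * m ≤ t ∧ t < l * (m + 1/2)) := by
    rintro ⟨h, h'⟩; exact ht ⟨h, by nlinarith⟩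
  have h2 : ¬ (l * (m + 1/2) ≤ t ∧ t < l * (m + 1)) := by
    rintro ⟨h, h'⟩; exact ht ⟨by nlinarith, h'⟩
  cases η <;> simp only [Set.indicator, Set.mem_Ico, if_neg ht, if_neg h1, if_neg h2] <;> simp

lemma integral_haar1D_true (k m : ℤ) : ∫ t, haar1D k m true t = 0 := by
  have hℓ : (0:ℝ) < 2 ^ (-k) := by positivity
  unfold haar1D
  generalize (2:ℝ) ^ (-k) = l at *
  have hint : ∀ a b : ℝ, Integrable ((Set.Ico a b).indicator (1 : ℝ → ℝ)) := fun a b =>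
    (integrable_indicator_iff measurableSet_Ico).2
      (integrableOn_const (by simp) : IntegrableOn (fun _ => (1:ℝ)) _ _)
  have hval : ∀ a b : ℝ, a ≤ b → ∫ t, (Set.Ico a b).indicator (1 : ℝ → ℝ) t = b - a := by
    intro a b hab
    rw [integral_indicator_one measurableSet_Ico]
    simp [measureReal_def, hab]
  simp only [if_true]
  rw [integral_const_mul, integral_sub (hint _ _) (hint _ _), hval _ _ (by nlinarith),
    hval _ _ (by nlinarith)]
  ring

lemma dyadicCube_eq_pi (n : ℕ) (k : ℤ) (m : Fin n → ℤ) :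
    dyadicCube n k m =
      Set.univ.pi fun i => Set.Ico ((2:ℝ) ^ (-k) * m i) ((2:ℝ) ^ (-k) * (m i + 1)) := by
  ext x; simp [dyadicCube, Set.mem_pi]

lemma measurableSet_dyadicCube (n : ℕ) (k : ℤ) (m : Fin n → ℤ) :
    MeasurableSet (dyadicCube n k m) := by
  rw [dyadicCube_eq_pi]
  exact MeasurableSet.univ_pi fun _ => measurableSet_Ico

lemma volume_dyadicCube (n : ℕ) (k : ℤ) (m : Fin n → ℤ) :
    volume (dyadicCube n k m) = ENNReal.ofReal (((2:ℝ) ^ (-k)) ^ n) := by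
  rw [dyadicCube_eq_pi, volume_pi_pi]
  simp only [Real.volume_Ico]
  have : ∀ i, (2:ℝ) ^ (-k) * (m i + 1) - (2:ℝ) ^ (-k) * m i = (2:ℝ) ^ (-k) := fun i => by ring
  simp only [this, Finset.prod_const, Finset.card_univ, Fintype.card_fin]
  rw [ENNReal.ofReal_pow (by positivity)]

lemma haarFn_measurable (n : ℕ) (k : ℤ) (m : Fin n → ℤ) (η : Fin n → Bool) :
    Measurable (haarFn n k m η) := by
  unfold haarFn
  exact Finset.measurable_prod _ fun i _ =>
    (haar1D_measurable k (m i) (η i)).comp (measurable_pi_apply i)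

lemma haarFn_eq_zero (n : ℕ) (k : ℤ) (m : Fin n → ℤ) (η : Fin n → Bool) (x : Fin n → ℝ)
    (hx : x ∉ dyadicCube n k m) : haarFn n k m η x = 0 := by
  simp only [dyadicCube, Set.mem_ofPred_eq, not_forall] at hx
  obtain ⟨i, hi⟩ := hx
  exact Finset.prod_eq_zero (Finset.mem_univ i) (haar1D_eq_zero _ _ _ _ hi)

lemma abs_haarFn_le (n : ℕ) (k : ℤ) (m : Fin n → ℤ) (η : Fin n → Bool) (x : Fin n → ℝ) :
    |haarFn n k m η x| ≤ (Real.sqrt ((2:ℝ) ^ (-k)))⁻¹ ^ n := by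
  unfold haarFn
  rw [Finset.abs_prod]
  calc ∏ i, |haar1D k (m i) (η i) (x i)| ≤ ∏ _i : Fin n, (Real.sqrt ((2:ℝ) ^ (-k)))⁻¹ :=
        Finset.prod_le_prod (fun _ _ => abs_nonneg _) fun i _ => abs_haar1D_le _ _ _ _
    _ = _ := by simp

lemma integrable_indicator_dyadicCube (n : ℕ) (k : ℤ) (m : Fin n → ℤ) (c : ℝ) :
    Integrable ((dyadicCube n k m).indicator fun _ => c) :=
  (integrable_indicator_iff (measurableSet_dyadicCube n k m)).2
    (integrableOn_const (by simp [volume_dyadicCube]))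

lemma integral_indicator_dyadicCube (n : ℕ) (k : ℤ) (m : Fin n → ℤ) (c : ℝ) :
    ∫ x, (dyadicCube n k m).indicator (fun _ => c) x = ((2:ℝ) ^ (-k)) ^ n * c := by
  rw [integral_indicator_const _ (measurableSet_dyadicCube n k m), measureReal_def,
    volume_dyadicCube, ENNReal.toReal_ofReal (by positivity), smul_eq_mul]

lemma integrable_haarFn (n : ℕ) (k : ℤ) (m : Fin n → ℤ) (η : Fin n → Bool) :
    Integrable (haarFn n k m η) := by
  refine (integrable_indicator_dyadicCube n k m ((Real.sqrt ((2:ℝ) ^ (-k)))⁻¹ ^ n)).mono'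
    (haarFn_measurable n k m η).aestronglyMeasurable (ae_of_all _ fun x => ?_)
  by_cases hx : x ∈ dyadicCube n k m
  · simpa [hx] using abs_haarFn_le n k m η x
  · simp [hx, haarFn_eq_zero]

lemma integral_haarFn_eq_zero (n : ℕ) (k : ℤ) (m : Fin n → ℤ) (η : Fin n → Bool)
    (hη : η ≠ fun _ => false) : ∫ x, haarFn n k m η x = 0 := by
  unfold haarFn
  rw [integral_fintype_prod_volume_eq_prod (fun i => haar1D k (m i) (η i))]
  obtain ⟨i, hi⟩ := Function.ne_iff.1 hη
  refine Finset.prod_eq_zero (Finset.mem_univ i) ?_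
  rw [show η i = true by simpa using hi]
  exact integral_haar1D_true _ _

/-- The pairing of a cancellative Haar function with `F` is controlled by the oscillation of `F`
around any constant. -/
lemma abs_pairing_haarFn_le (n : ℕ) (k : ℤ) (m : Fin n → ℤ) (θ : Fin n → Bool)
    (hθ : θ ≠ fun _ => false) (F : (Fin n → ℝ) → ℝ) (a B : ℝ) (hB : 0 ≤ B)
    (hF : ∀ x ∈ dyadicCube n k m, |F x - a| ≤ B) :
    |pairing (haarFn n k m θ) F| ≤
      ((2:ℝ) ^ (-k)) ^ n * ((Real.sqrt ((2:ℝ) ^ (-k)))⁻¹ ^ n * B) := by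
  unfold pairing
  by_cases hint : Integrable fun x => haarFn n k m θ x * F x
  · have h1 : ∫ x, haarFn n k m θ x * F x = ∫ x, haarFn n k m θ x * (F x - a) := by
      simp only [mul_sub]
      rw [integral_sub hint ((integrable_haarFn n k m θ).mul_const a), integral_mul_const,
        integral_haarFn_eq_zero n k m θ hθ]
      ring
    rw [h1, ← integral_indicator_dyadicCube n k m]
    rw [← Real.norm_eq_abs]
    refine norm_integral_le_of_norm_le (integrable_indicator_dyadicCube n k m _)
      (ae_of_all _ fun x => ?_)
    by_cases hx : x ∈ dyadicCube n k m
    · simp only [Set.indicator_of_mem hx, Real.norm_eq_abs, abs_mul]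
      exact mul_le_mul (abs_haarFn_le n k m θ x) (hF x hx) (abs_nonneg _) (by positivity)
    · simp [hx, haarFn_eq_zero]
  · rw [integral_undef hint, abs_zero]
    positivity

lemma abs_pairing_haarFn_haarZero_le (n : ℕ) (k k' : ℤ) (m m' : Fin n → ℤ) (η : Fin n → Bool) :
    |pairing (haarFn n k' m' η) (haarZero n k m)| ≤
      ((2:ℝ) ^ (-k)) ^ n *
        ((Real.sqrt ((2:ℝ) ^ (-k')))⁻¹ ^ n * (Real.sqrt ((2:ℝ) ^ (-k)))⁻¹ ^ n) := by
  unfold pairing haarZero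
  rw [← integral_indicator_dyadicCube n k m]
  rw [← Real.norm_eq_abs]
  refine norm_integral_le_of_norm_le (integrable_indicator_dyadicCube n k m _)
    (ae_of_all _ fun x => ?_)
  by_cases hx : x ∈ dyadicCube n k m
  · simp only [Set.indicator_of_mem hx, Real.norm_eq_abs, abs_mul]
    exact mul_le_mul (abs_haarFn_le _ _ _ _ _) (abs_haarFn_le _ _ _ _ _) (abs_nonneg _)
      (by positivity)
  · simp [hx, haarFn_eq_zero]

lemma IsNormalisedKernel.continuousOn {n : ℕ} {γ : ℝ} (hγ : 0 < γ)
    {K : (Fin n → ℝ) → (Fin n → ℝ) → ℝ} (hK : IsNormalisedKernel n γ K) (x : Fin n → ℝ) :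
    ContinuousOn (K x) {y | x ≠ y} := by
  intro y hy
  refine ContinuousAt.continuousWithinAt ?_
  have hd : 0 < dist x y := dist_pos.2 hy
  rw [ContinuousAt, tendsto_iff_norm_sub_tendsto_zero]
  have hlim : Filter.Tendsto (fun z => ‖z - y‖ ^ γ * dist x y ^ (-(n:ℝ) - γ)) (nhds y) (nhds 0) := by
    have : Filter.Tendsto (fun z => ‖z - y‖ ^ γ * dist x y ^ (-(n:ℝ) - γ)) (nhds y)
        (nhds (‖y - y‖ ^ γ * dist x y ^ (-(n:ℝ) - γ))) := by
      refine Filter.Tendsto.mul_const _ (Filter.Tendsto.rpow_const ?_ (Or.inr hγ.le))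
      exact (by fun_prop : Continuous fun z : Fin n → ℝ => ‖z - y‖).tendsto y
    simpa [Real.zero_rpow hγ.ne'] using this
  refine squeeze_zero' (Filter.Eventually.of_forall fun _ => norm_nonneg _) ?_ hlim
  have : ∀ᶠ z in nhds y, dist z y < dist x y / 2 := Metric.ball_mem_nhds y (by positivity)
  filter_upwards [this] with z hz
  have h := hK.smooth x y (z - y) (by rw [← dist_eq_norm]; linarith)
  rw [add_sub_cancel] at h
  rw [Real.norm_eq_abs]
  linarith [abs_nonneg (K (x + (z - y)) y - K x y)]

lemma IsNormalisedKernel.abs_le_of_lt_dist {n : ℕ} {γ : ℝ}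
    {K : (Fin n → ℝ) → (Fin n → ℝ) → ℝ} (hK : IsNormalisedKernel n γ K) {ε : ℝ} (hε : 0 < ε)
    {x y : Fin n → ℝ} (h : ε < dist x y) : |K x y| ≤ (ε ^ n)⁻¹ := by
  refine (hK.size x y (dist_pos.1 (hε.trans h))).trans ?_
  rw [Real.rpow_neg dist_nonneg, Real.rpow_natCast]
  exact inv_anti₀ (by positivity) (pow_le_pow_left₀ hε.le h.le n)

lemma IsNormalisedKernel.integrableOn_mul {n : ℕ} {γ : ℝ} (hγ : 0 < γ)
    {K : (Fin n → ℝ) → (Fin n → ℝ) → ℝ} (hK : IsNormalisedKernel n γ K) {ε : ℝ} (hε : 0 < ε)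
    (x : Fin n → ℝ) {f : (Fin n → ℝ) → ℝ} (hf : Integrable f) :
    IntegrableOn (fun y => K x y * f y) {y | ε < dist x y} := by
  have hm : MeasurableSet {y | ε < dist x y} :=
    (isOpen_lt continuous_const (continuous_const.dist continuous_id)).measurableSet
  refine hf.integrableOn.bdd_mul (c := (ε ^ n)⁻¹) ?_ ?_
  · exact ((hK.continuousOn hγ x).mono fun y hy => dist_pos.1 (hε.trans hy)).aestronglyMeasurable hm
  · filter_upwards [ae_restrict_mem hm] with y hy
    exact hK.abs_le_of_lt_dist hε hy

/-- The part of a dyadic cube lying in the shell of width `w` around an `ℓ∞`-sphere is covered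
by at most `2n` slabs. -/
lemma volume_dyadicCube_inter_shell_le (n : ℕ) (hn : 0 < n) (k : ℤ) (m : Fin n → ℤ)
    (c : Fin n → ℝ) (ε w : ℝ) (hw : 0 ≤ w) :
    volume.real (dyadicCube n k m ∩ {y | |dist c y - ε| ≤ w / 2}) ≤
      2 * n * (w * ((2:ℝ) ^ (-k)) ^ (n - 1)) := by
  classical
  let slab : Fin n → ℝ → Set (Fin n → ℝ) := fun i a =>
    Set.univ.pi (Function.update
      (fun i' => Set.Ico ((2:ℝ) ^ (-k) * m i') ((2:ℝ) ^ (-k) * (m i' + 1))) i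
      (Set.Icc (a - w / 2) (a + w / 2)))
  have hslab : ∀ i a, volume.real (slab i a) = w * ((2:ℝ) ^ (-k)) ^ (n - 1) := by
    intro i a
    rw [measureReal_def, volume_pi_pi, ENNReal.toReal_prod,
      ← Finset.mul_prod_erase _ _ (Finset.mem_univ i)]
    congr 1
    · rw [Function.update_self, Real.volume_Icc, ENNReal.toReal_ofReal] <;> linarith
    · rw [Finset.prod_congr rfl (g := fun _ => (2:ℝ) ^ (-k))]
      · simp
      · intro i' hi'
        rw [Function.update_of_ne (Finset.ne_of_mem_erase hi'), Real.volume_Ico,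
          ENNReal.toReal_ofReal] <;> ring_nf <;> positivity
  have hfin : ∀ i a, volume (slab i a) ≠ ⊤ := by
    intro i a
    rw [volume_pi_pi]
    refine ENNReal.prod_ne_top fun i' _ => ?_
    by_cases h : i' = i
    · subst h; simp
    · simp [Function.update_of_ne h]
  have hcover : dyadicCube n k m ∩ {y | |dist c y - ε| ≤ w / 2} ⊆
      ⋃ i ∈ (Finset.univ : Finset (Fin n)), (slab i (c i + ε) ∪ slab i (c i - ε)) := by
    rintro y ⟨hy, hs⟩
    obtain ⟨i, -, hi⟩ := Finset.exists_mem_eq_sup (Finset.univ : Finset (Fin n))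
      ⟨⟨0, hn⟩, Finset.mem_univ _⟩ fun i => nndist (c i) (y i)
    have hd : dist c y = |c i - y i| := by
      rw [← Real.dist_eq, dist_pi_def, hi, coe_nndist]
    rw [Set.mem_ofPred_eq, hd, abs_le] at hs
    simp only [Finset.mem_univ, Set.iUnion_true, Set.mem_iUnion]
    refine ⟨i, ?_⟩
    have key : ∀ a, a - w / 2 ≤ y i → y i ≤ a + w / 2 → y ∈ slab i a := by
      intro a h1 h2 i' _
      by_cases h : i' = i
      · subst h; simpa using ⟨by linarith, h2⟩
      · simpa [Function.update_of_ne h] using hy i'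
    rcases abs_cases (c i - y i) with ⟨h, _⟩ | ⟨h, _⟩
    · exact Or.inr (key _ (by linarith [hs.2]) (by linarith [hs.1]))
    · exact Or.inl (key _ (by linarith [hs.1]) (by linarith [hs.2]))
  have hfinU : volume (⋃ i ∈ (Finset.univ : Finset (Fin n)),
      (slab i (c i + ε) ∪ slab i (c i - ε))) ≠ ⊤ :=
    ((measure_biUnion_finset_le _ _).trans_lt (ENNReal.sum_lt_top.2 fun i _ =>
      measure_union_lt_top (hfin _ _).lt_top (hfin _ _).lt_top)).ne
  calc _ ≤ _ := measureReal_mono hcover hfinU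
    _ ≤ ∑ i, volume.real (slab i (c i + ε) ∪ slab i (c i - ε)) := measureReal_biUnion_finset_le _ _
    _ ≤ ∑ _i : Fin n, 2 * (w * ((2:ℝ) ^ (-k)) ^ (n - 1)) := by
        refine Finset.sum_le_sum fun i _ => (measureReal_union_le _ _).trans ?_
        rw [hslab, hslab]; linarith
    _ = _ := by simp; ring

lemma abs_czTrunc_haarFn_sub_le {n : ℕ} (hn : 0 < n) {γ : ℝ} (hγ : 0 < γ)
    {K : (Fin n → ℝ) → (Fin n → ℝ) → ℝ} (hK : IsNormalisedKernel n γ K) {ε : ℝ} (hε : 0 < ε)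
    (k : ℤ) (m : Fin n → ℤ) (η : Fin n → Bool) (x c : Fin n → ℝ) (w a b : ℝ) (hw : 0 ≤ w)
    (ha : 0 ≤ a) (hb : 0 ≤ b) (hxc : dist x c ≤ w / 2)
    (hsmooth : ∀ y ∈ dyadicCube n k m, ε < dist x y → |K x y - K c y| ≤ a)
    (hshell : ∀ y ∈ dyadicCube n k m, |dist c y - ε| ≤ w / 2 → (ε ^ n)⁻¹ ≤ b) :
    |czTrunc K ε (haarFn n k m η) x - czTrunc K ε (haarFn n k m η) c| ≤
      (Real.sqrt ((2:ℝ) ^ (-k)))⁻¹ ^ n *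
        (((2:ℝ) ^ (-k)) ^ n * a + 2 * n * (w * ((2:ℝ) ^ (-k)) ^ (n - 1)) * b) := by
  have hm : ∀ x : Fin n → ℝ, MeasurableSet {y | ε < dist x y} := fun x =>
    (isOpen_lt continuous_const (continuous_const.dist continuous_id)).measurableSet
  have hi : ∀ x : Fin n → ℝ, Integrable
      ({y | ε < dist x y}.indicator fun y => K x y * haarFn n k m η y) := fun x =>
    (integrable_indicator_iff (hm x)).2 (hK.integrableOn_mul hγ hε x (integrable_haarFn n k m η))
  set r := (Real.sqrt ((2:ℝ) ^ (-k)))⁻¹ ^ n with hr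
  have hr0 : 0 ≤ r := by positivity
  set S := {y : Fin n → ℝ | |dist c y - ε| ≤ w / 2} with hS
  have hSm : MeasurableSet S := by
    apply IsClosed.measurableSet
    exact isClosed_le (by fun_prop) continuous_const
  have hJS : MeasurableSet (dyadicCube n k m ∩ S) := (measurableSet_dyadicCube n k m).inter hSm
  have hJSfin : volume (dyadicCube n k m ∩ S) ≠ ⊤ :=
    ((measure_mono Set.inter_subset_left).trans_lt (by simp [volume_dyadicCube])).ne
  have hJSi : Integrable ((dyadicCube n k m ∩ S).indicator fun _ => r * b) :=
    (integrable_indicator_iff hJS).2 (integrableOn_const hJSfin)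
  unfold czTrunc
  rw [← integral_indicator (hm x), ← integral_indicator (hm c), ← integral_sub (hi x) (hi c)]
  calc _ ≤ ∫ y, ((dyadicCube n k m).indicator (fun _ => r * a) y +
          (dyadicCube n k m ∩ S).indicator (fun _ => r * b) y) := by
        rw [← Real.norm_eq_abs]
        refine norm_integral_le_of_norm_le
          ((integrable_indicator_dyadicCube n k m _).add hJSi) (ae_of_all _ fun y => ?_)
        by_cases hy : y ∈ dyadicCube n k m
        swap
        · simp [hy, haarFn_eq_zero, Set.indicator]
        have hh := abs_haarFn_le n k m η y
        rw [← hr] at hh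
        have hshell0 : 0 ≤ (dyadicCube n k m ∩ S).indicator (fun _ => r * b) y :=
          Set.indicator_nonneg (fun _ _ => by positivity) _
        have htri1 := dist_triangle x c y
        have htri2 := dist_triangle c x y
        rw [dist_comm c x] at htri2
        rw [Set.indicator_of_mem hy]
        by_cases h1 : ε < dist x y <;> by_cases h2 : ε < dist c y
        · rw [Set.indicator_of_mem (show y ∈ {y | ε < dist x y} from h1),
            Set.indicator_of_mem (show y ∈ {y | ε < dist c y} from h2), ← sub_mul,
            Real.norm_eq_abs, abs_mul, mul_comm]
          have := mul_le_mul hh (hsmooth y hy h1) (abs_nonneg _) hr0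
          linarith
        · have hyS : |dist c y - ε| ≤ w / 2 := abs_le.2 ⟨by linarith, by linarith⟩
          rw [Set.indicator_of_mem (show y ∈ {y | ε < dist x y} from h1),
            Set.indicator_of_notMem (show y ∉ {y | ε < dist c y} from h2), sub_zero,
            Set.indicator_of_mem (show y ∈ dyadicCube n k m ∩ S from ⟨hy, hyS⟩),
            Real.norm_eq_abs, abs_mul, mul_comm]
          have := mul_le_mul hh ((hK.abs_le_of_lt_dist hε h1).trans (hshell y hy hyS))
            (abs_nonneg _) hr0
          linarith [mul_nonneg hr0 ha]
        · have hyS : |dist c y - ε| ≤ w / 2 := abs_le.2 ⟨by linarith, by linarith⟩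
          rw [Set.indicator_of_notMem (show y ∉ {y | ε < dist x y} from h1),
            Set.indicator_of_mem (show y ∈ {y | ε < dist c y} from h2), zero_sub, norm_neg,
            Set.indicator_of_mem (show y ∈ dyadicCube n k m ∩ S from ⟨hy, hyS⟩),
            Real.norm_eq_abs, abs_mul, mul_comm]
          have := mul_le_mul hh ((hK.abs_le_of_lt_dist hε h2).trans (hshell y hy hyS))
            (abs_nonneg _) hr0
          linarith [mul_nonneg hr0 ha]
        · rw [Set.indicator_of_notMem (show y ∉ {y | ε < dist x y} from h1),
            Set.indicator_of_notMem (show y ∉ {y | ε < dist c y} from h2), sub_zero, norm_zero]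
          linarith [mul_nonneg hr0 ha]
    _ = ((2:ℝ) ^ (-k)) ^ n * (r * a) + volume.real (dyadicCube n k m ∩ S) * (r * b) := by
        rw [integral_add (integrable_indicator_dyadicCube n k m _) hJSi,
          integral_indicator_dyadicCube, integral_indicator_const _ hJS, smul_eq_mul]
    _ ≤ ((2:ℝ) ^ (-k)) ^ n * (r * a) + 2 * n * (w * ((2:ℝ) ^ (-k)) ^ (n - 1)) * (r * b) := by
        gcongr
        exact volume_dyadicCube_inter_shell_le n hn k m c ε w hw
    _ = _ := by ring

lemma dist_cubeCenter_le (n : ℕ) (k : ℤ) (m : Fin n → ℤ) (x : Fin n → ℝ)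
    (hx : x ∈ dyadicCube n k m) : dist x (cubeCenter n k m) ≤ (2:ℝ) ^ (-k) / 2 := by
  refine (dist_pi_le_iff (by positivity)).2 fun i => ?_
  have := hx i
  rw [Real.dist_eq, abs_le, cubeCenter]
  constructor <;> nlinarith

lemma cubeCenter_mem (n : ℕ) (k : ℤ) (m : Fin n → ℤ) : cubeCenter n k m ∈ dyadicCube n k m := by
  have : (0:ℝ) < 2 ^ (-k) := by positivity
  intro i
  unfold cubeCenter
  constructor <;> nlinarith

lemma dist_le_of_mem_dyadicCube (n : ℕ) (k : ℤ) (m : Fin n → ℤ) (x y : Fin n → ℝ)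
    (hx : x ∈ dyadicCube n k m) (hy : y ∈ dyadicCube n k m) : dist x y ≤ (2:ℝ) ^ (-k) := by
  have h := dist_triangle_right x y (cubeCenter n k m)
  linarith [dist_cubeCenter_le n k m x hx, dist_cubeCenter_le n k m y hy]

lemma dist_cubeCenter_add (n : ℕ) (k : ℤ) (m m' : Fin n → ℤ) :
    dist (cubeCenter n k m) (cubeCenter n k (m + m')) = (2:ℝ) ^ (-k) * inorm m' := by
  rw [dist_comm, dist_eq_norm, inorm]
  have : cubeCenter n k (m + m') - cubeCenter n k m =
      (2:ℝ) ^ (-k) • fun i => (m' i : ℝ) := by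
    ext i
    simp [cubeCenter]
    ring
  rw [this, norm_smul, Real.norm_of_nonneg (by positivity)]

lemma indR_nonneg (P : Prop) : 0 ≤ indR P := by
  unfold indR; split_ifs <;> norm_num

lemma indR_of {P : Prop} (h : P) : indR P = 1 := by
  simp [indR, h]

lemma rpow_mul_half_rpow_le (n : ℕ) {γ l M : ℝ} (hγ1 : γ ≤ 1) (hl : 0 < l)
    (hM : 0 < M) :
    l ^ γ * (l * M / 2) ^ (-(n:ℝ) - γ) ≤ (l ^ n)⁻¹ * (2 ^ (n + 1) * M ^ (-(n:ℝ) - γ)) := by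
  have h2 : (2:ℝ)⁻¹ ^ (-(n:ℝ) - γ) ≤ 2 ^ (n + 1) := by
    rw [Real.inv_rpow (by norm_num), ← Real.rpow_neg (by norm_num), ← Real.rpow_natCast]
    exact Real.rpow_le_rpow_of_exponent_le (by norm_num) (by push_cast; linarith)
  have h3 : l ^ γ * l ^ (-(n:ℝ) - γ) = (l ^ n)⁻¹ := by
    rw [← Real.rpow_add hl, ← Real.rpow_natCast, ← Real.rpow_neg hl.le]
    congr 1; ring
  rw [div_eq_mul_inv, Real.mul_rpow (by positivity) (by norm_num), Real.mul_rpow hl.le hM.le]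
  calc _ = (l ^ γ * l ^ (-(n:ℝ) - γ)) * ((2:ℝ)⁻¹ ^ (-(n:ℝ) - γ) * M ^ (-(n:ℝ) - γ)) := by ring
    _ ≤ _ := by rw [h3]; gcongr

lemma inv_sqrt_pow_mul_self (n : ℕ) {t : ℝ} (ht : 0 < t) :
    (Real.sqrt t)⁻¹ ^ n * (Real.sqrt t)⁻¹ ^ n = (t ^ n)⁻¹ := by
  rw [← mul_pow, ← mul_inv, Real.mul_self_sqrt ht.le, inv_pow]

/-- The normalising factors of the Haar functions cancel. -/
lemma haar_constants_le {n : ℕ} (hn : 0 < n) {l P Q I₁ I₂ D : ℝ} (hl : 0 < l) (hP : 0 < P)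
    (hQ : 0 < Q) (hI₁ : 0 ≤ I₁) (hI₂ : 0 ≤ I₂) (hD : 0 ≤ D) :
    l ^ n * ((Real.sqrt l)⁻¹ ^ n * ((Real.sqrt (P * l))⁻¹ ^ n *
        ((P * l) ^ n * (I₁ * ((l ^ n)⁻¹ * (2 ^ (n + 1) * D))) +
          2 * n * (l * (P * l) ^ (n - 1)) * (I₂ * ((Q * P * l) ^ n)⁻¹)))) *
      (l ^ n * ((Real.sqrt (P * l))⁻¹ ^ n * (Real.sqrt l)⁻¹ ^ n)) ≤
    (2 ^ (n + 1) + 2 * n) * (I₁ * D + I₂ * ((Q ^ n)⁻¹ * (P ^ (n + 1))⁻¹)) := by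
  have hPl : (P * l) ^ n = (P * l) ^ (n - 1) * (P * l) := by
    rw [← pow_succ, Nat.sub_add_cancel hn]
  have hR : 0 < (P * l) ^ (n - 1) := by positivity
  generalize ha : I₁ * ((l ^ n)⁻¹ * (2 ^ (n + 1) * D)) = a
  generalize hb : I₂ * ((Q * P * l) ^ n)⁻¹ = b
  calc _ = (l ^ n * l ^ n) * ((Real.sqrt l)⁻¹ ^ n * (Real.sqrt l)⁻¹ ^ n) *
          ((Real.sqrt (P * l))⁻¹ ^ n * (Real.sqrt (P * l))⁻¹ ^ n) *
          ((P * l) ^ n * a + 2 * n * (l * (P * l) ^ (n - 1)) * b) := by ring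
    _ = l ^ n * (a + 2 * n * (P⁻¹ * b)) := by
        rw [inv_sqrt_pow_mul_self n hl, inv_sqrt_pow_mul_self n (by positivity : 0 < P * l), hPl]
        generalize (P * l) ^ (n - 1) = R at hR
        field_simp
    _ = 2 ^ (n + 1) * (I₁ * D) + 2 * n * (I₂ * ((Q ^ n)⁻¹ * (P ^ (n + 1))⁻¹)) := by
        rw [← ha, ← hb, mul_pow, mul_pow, pow_succ P n]
        have h1 : 0 < l ^ n := by positivity
        have h2 : 0 < P ^ n := by positivity
        have h3 : 0 < Q ^ n := by positivity
        generalize l ^ n = l' at *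
        generalize P ^ n = P' at *
        generalize Q ^ n = Q' at *
        field_simp
    _ ≤ _ := by
        have h1 : 0 ≤ I₁ * D := by positivity
        have h2 : 0 ≤ I₂ * ((Q ^ n)⁻¹ * (P ^ (n + 1))⁻¹) := by positivity
        rw [mul_add]
        gcongr
        · exact le_add_of_nonneg_right (by positivity)
        · exact le_add_of_nonneg_left (by positivity)

/-- Lemma 5.6: bound for `⟨h^θ_K, T_{4·2^s ℓ(J)} h^η_J⟩ ⟨h^η_J, h⁰_L⟩`, where
`ℓ(K) = ℓ(L)`, `L = K∔m`, and `J ⊋ L` with `ℓ(J) = 2^j ℓ(L)`. -/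
theorem statement16 (n : ℕ) (hn : 0 < n) (γ : ℝ) (hγ0 : 0 < γ) (hγ1 : γ ≤ 1) :
    ∃ C : ℝ, 0 < C ∧
      ∀ K : (Fin n → ℝ) → (Fin n → ℝ) → ℝ, IsNormalisedKernel n γ K →
      ∀ (s j : ℕ), 1 ≤ j →
      ∀ (k : ℤ) (mK m mJ : Fin n → ℤ) (θ η : Fin n → Bool),
        θ ≠ (fun _ => false) → η ≠ (fun _ => false) →
        dyadicCube n k (mK + m) ⊆ dyadicCube n (k - j) mJ →
        |pairing (haarFn n k mK θ)
              (czTrunc K (4 * 2^s * sideLen (k - j)) (haarFn n (k - j) mJ η)) *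
            pairing (haarFn n (k - j) mJ η) (haarZero n k (mK + m))| ≤
          C * (indR (2 * 2^(s+j) < inorm m) * inorm m ^ (-(n:ℝ) - γ) +
              indR (|inorm m - 4 * 2^(s+j)| < 1 + 2^j) *
                ((2:ℝ) ^ (-(s:ℝ) * (n:ℝ)) * (2:ℝ) ^ (-(j:ℝ) * ((n:ℝ) + 1)))) := by
  refine ⟨2 ^ (n + 1) + 2 * n, by positivity, ?_⟩
  intro K hK s j hj k mK m mJ θ η hθ hη hLJ
  set l : ℝ := (2:ℝ) ^ (-k) with hl
  have hl0 : 0 < l := by positivity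
  set P : ℝ := (2:ℝ) ^ j with hP
  have hP2 : 2 ≤ P := by
    calc (2:ℝ) = 2 ^ 1 := by norm_num
      _ ≤ 2 ^ j := pow_le_pow_right₀ (by norm_num) hj
  set Q : ℝ := (2:ℝ) ^ s with hQ
  have hQ1 : 1 ≤ Q := one_le_pow₀ (by norm_num)
  have hPQ : P ≤ Q * P := by nlinarith
  have hside : (2:ℝ) ^ (-(k - (j:ℤ))) = P * l := by
    rw [show -(k - (j:ℤ)) = (j:ℤ) + -k by ring, zpow_add₀ (by norm_num), zpow_natCast]
  have hsideLen : sideLen (k - j) = P * l := hside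
  rw [hsideLen, pow_add (2:ℝ) s j, ← hQ, ← hP]
  set ε : ℝ := 4 * Q * (P * l) with hε
  have hε0 : 0 < ε := by positivity
  set M := inorm m with hM
  set c := cubeCenter n k mK with hc
  set I1 := indR (2 * (Q * P) < M) with hI1
  set I2 := indR (|M - 4 * (Q * P)| < 1 + P) with hI2
  have hI1n : 0 ≤ I1 := indR_nonneg _
  have hI2n : 0 ≤ I2 := indR_nonneg _
  have hM0 : 0 ≤ M := norm_nonneg _
  set a : ℝ := I1 * ((l ^ n)⁻¹ * (2 ^ (n + 1) * M ^ (-(n:ℝ) - γ))) with ha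
  set b : ℝ := I2 * ((Q * P * l) ^ n)⁻¹ with hb
  have ha0 : 0 ≤ a := by positivity
  have hb0 : 0 ≤ b := by positivity
  have hdist : ∀ y ∈ dyadicCube n (k - j) mJ, |dist c y - l * M| ≤ P * l := by
    intro y hy
    have h := dist_le_of_mem_dyadicCube n (k - j) mJ _ y (hLJ (cubeCenter_mem n k (mK + m))) hy
    have h' := dist_cubeCenter_add n k mK m
    rw [← hc, ← hM, ← hl] at h'
    rw [hside] at h
    rw [← h', abs_le]
    constructor <;>
      linarith [dist_triangle c (cubeCenter n k (mK + m)) y,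
        dist_triangle_right c (cubeCenter n k (mK + m)) y]
  have hlP : 2 * l ≤ P * l := by nlinarith
  have hlPQ : P * l ≤ Q * P * l := by nlinarith
  have hF : ∀ x ∈ dyadicCube n k mK,
      |czTrunc K ε (haarFn n (k - j) mJ η) x - czTrunc K ε (haarFn n (k - j) mJ η) c| ≤
        (Real.sqrt (P * l))⁻¹ ^ n *
          ((P * l) ^ n * a + 2 * n * (l * (P * l) ^ (n - 1)) * b) := by
    intro x hx
    have hxc : dist x c ≤ l / 2 := dist_cubeCenter_le n k mK x hx
    rw [← hside]
    refine abs_czTrunc_haarFn_sub_le hn hγ0 hK hε0 (k - j) mJ η x c l a b hl0.le ha0 hb0 hxc ?_ ?_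
    · intro y hy hxy
      have hd := abs_le.1 (hdist y hy)
      have htri := dist_triangle x c y
      have hMl : l * (2 * (Q * P)) < l * M := by linarith [hd.1, hd.2]
      have hMgt : 2 * (Q * P) < M := lt_of_mul_lt_mul_left hMl hl0.le
      have hM' : 0 < M := (by positivity : 0 < 2 * (Q * P)).trans hMgt
      have hcy : l * M / 2 ≤ dist c y := by linarith [hd.1]
      have hcy' : 2 * ‖x - c‖ < dist c y := by
        rw [← dist_eq_norm]; linarith
      have h := hK.smooth c y (x - c) hcy'
      rw [add_sub_cancel] at h
      calc |K x y - K c y| ≤ ‖x - c‖ ^ γ * dist c y ^ (-(n:ℝ) - γ) := by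
            linarith [abs_nonneg (K c (y + (x - c)) - K c y)]
        _ ≤ l ^ γ * (l * M / 2) ^ (-(n:ℝ) - γ) := by
            refine mul_le_mul (Real.rpow_le_rpow (norm_nonneg _) ?_ hγ0.le)
              (Real.rpow_le_rpow_of_nonpos (by positivity) hcy ?_) (by positivity) (by positivity)
            · rw [← dist_eq_norm]; linarith
            · have : (0:ℝ) ≤ n := n.cast_nonneg
              linarith
        _ ≤ a := by
            rw [ha, hI1, indR_of hMgt, one_mul]
            exact rpow_mul_half_rpow_le n hγ1 hl0 hM'
    · intro y hy hyS
      have hd := abs_le.1 (hdist y hy)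
      have hs := abs_le.1 hyS
      have hin : |M - 4 * (Q * P)| < 1 + P := by
        refine lt_of_mul_lt_mul_left (a := l) ?_ hl0.le
        have hscale : l * |M - 4 * (Q * P)| = |l * M - ε| := by
          rw [← abs_of_pos hl0, ← abs_mul, abs_of_pos hl0, hε]
          ring_nf
        rw [hscale, abs_lt]
        constructor <;> linarith [hd.1, hd.2, hs.1, hs.2]
      rw [hb, hI2, indR_of hin, one_mul]
      refine inv_anti₀ (by positivity) (pow_le_pow_left₀ (by positivity) ?_ n)
      rw [hε]; linarith [(by positivity : 0 ≤ Q * P * l)]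
  have hp1 := abs_pairing_haarFn_le n k mK θ hθ _ _ _ (by positivity) hF
  have hp2 := abs_pairing_haarFn_haarZero_le n k (k - j) (mK + m) mJ η
  rw [← hl] at hp1 hp2
  rw [hside] at hp2
  rw [abs_mul]
  refine (mul_le_mul hp1 hp2 (abs_nonneg _) (by positivity)).trans ?_
  have hexp : (2:ℝ) ^ (-(s:ℝ) * (n:ℝ)) * (2:ℝ) ^ (-(j:ℝ) * ((n:ℝ) + 1)) =
      (Q ^ n)⁻¹ * (P ^ (n + 1))⁻¹ := by
    rw [neg_mul, neg_mul, Real.rpow_neg (by norm_num), Real.rpow_neg (by norm_num),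
      Real.rpow_mul (by norm_num), Real.rpow_mul (by norm_num), Real.rpow_natCast,
      Real.rpow_natCast, Real.rpow_natCast, ← Nat.cast_succ, Real.rpow_natCast]
  rw [hexp]
  rw [ha, hb]
  exact haar_constants_le hn hl0 (by positivity) (by positivity) hI1n hI2n (by positivity)

end
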